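/- arXiv:2510.21262 — 4 statements merged into one kernel-verified Lean document; each statement's English description precedes it below -/
import Mathlib

section
/- Let (X, 𝒜, μ) be a probability space, β > 0, and f : X → ℝ a bounded measurable function. Set Z = ∫ exp(f/β) dμ and p*(x) = exp(f(x)/β)/Z. If p is a probability density with respect to μ with ∫ p log p dμ finite and ∫ f·p dμ − β ∫ p log p dμ = β · log Z, then p = p* μ-almost everywhere. In other words, p* is the unique (up to μ-null sets) maximizer of p ↦ ∫ f·p dμ − β ∫ p log p dμ over probability densities. -/
open MeasureTheory

open InformationTheory in
/-- Equality case of Gibbs' inequality: `q * klFun (p / q)` has vanishing integral. -/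
theorem ae_eq_of_integral_mul_log_eq {X : Type*} [MeasurableSpace X] {μ : Measure X}
    {p q : X → ℝ} (hp_nonneg : ∀ᵐ x ∂μ, 0 ≤ p x) (hq_pos : ∀ᵐ x ∂μ, 0 < q x)
    (hp : Integrable p μ) (hq : Integrable q μ) (hpq : ∫ x, p x ∂μ = ∫ x, q x ∂μ)
    (hp_log : Integrable (fun x => p x * Real.log (p x)) μ)
    (hq_log : Integrable (fun x => p x * Real.log (q x)) μ)
    (h_log : ∫ x, p x * Real.log (p x) ∂μ = ∫ x, p x * Real.log (q x) ∂μ) :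
    p =ᵐ[μ] q := by
  have h_eq : (fun x => q x * klFun (p x / q x)) =ᵐ[μ]
      fun x => (p x * Real.log (p x) - p x * Real.log (q x)) + (q x - p x) := by
    filter_upwards [hp_nonneg, hq_pos] with x hpx hqx
    rcases hpx.eq_or_lt with h | h
    · simp [← h, klFun_zero]
    · rw [klFun_apply, Real.log_div h.ne' hqx.ne']
      field_simp
      ring
  have h_int : Integrable (fun x => q x * klFun (p x / q x)) μ :=
    ((hp_log.sub hq_log).add (hq.sub hp)).congr h_eq.symm
  have h_zero : ∫ x, q x * klFun (p x / q x) ∂μ = 0 := by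
    rw [integral_congr_ae h_eq, integral_add (by exact hp_log.sub hq_log) (by exact hq.sub hp),
      integral_sub hp_log hq_log, integral_sub hq hp, h_log, hpq]
    ring
  have h_nonneg : 0 ≤ᵐ[μ] fun x => q x * klFun (p x / q x) := by
    filter_upwards [hp_nonneg, hq_pos] with x hpx hqx
    exact mul_nonneg hqx.le (klFun_nonneg (div_nonneg hpx hqx.le))
  filter_upwards [(integral_eq_zero_iff_of_nonneg_ae h_nonneg h_int).1 h_zero, hp_nonneg, hq_pos]
    with x hx hpx hqx
  have hkl : klFun (p x / q x) = 0 := (mul_eq_zero.1 hx).resolve_left hqx.ne'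
  exact (div_eq_one_iff_eq hqx.ne').1 ((klFun_eq_zero_iff (div_nonneg hpx hqx.le)).1 hkl)

/-- Uniqueness of the Gibbs maximizer: for a probability space `(X, μ)`, `β > 0` and a bounded
measurable `f`, if a probability density `p` with finite entropy term attains the optimal value
`β · log Z` (with `Z = ∫ exp(f/β) dμ`) of the entropy-regularized functional, then `p` agrees
μ-almost everywhere with `p* = exp(f/β)/Z`. -/
theorem gibbs_density_unique_maximizer
    {X : Type*} [MeasurableSpace X] (μ : Measure X) [IsProbabilityMeasure μ]
    (β : ℝ) (hβ : 0 < β)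
    (f : X → ℝ) (hf_meas : Measurable f) (M : ℝ) (hf_bdd : ∀ x, |f x| ≤ M)
    (Z : ℝ) (hZ : Z = ∫ x, Real.exp (f x / β) ∂μ)
    (pstar : X → ℝ) (hpstar : ∀ x, pstar x = Real.exp (f x / β) / Z)
    (p : X → ℝ) (hp_meas : Measurable p) (hp_nonneg : ∀ᵐ x ∂μ, 0 ≤ p x)
    (hp_int : Integrable p μ) (hp_one : (∫ x, p x ∂μ) = 1)
    (hp_ent : Integrable (fun x => p x * Real.log (p x)) μ)
    (hp_attains : (∫ x, f x * p x ∂μ) - β * (∫ x, p x * Real.log (p x) ∂μ)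
      = β * Real.log Z) :
    p =ᵐ[μ] pstar := by
  have hexp : Integrable (fun x => Real.exp (f x / β)) μ := by
    refine Integrable.of_bound (by fun_prop) (Real.exp (M / β)) (.of_forall fun x => ?_)
    rw [Real.norm_eq_abs, Real.abs_exp]
    gcongr
    exact (le_abs_self _).trans (hf_bdd x)
  have hZ_pos : 0 < Z := hZ ▸ integral_exp_pos hexp
  obtain rfl : pstar = fun x => Real.exp (f x / β) / Z := funext hpstar
  have hfp : Integrable (fun x => f x * p x) μ :=
    hp_int.bdd_mul (c := M) hf_meas.aestronglyMeasurable (.of_forall hf_bdd)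
  have h_log : (fun x => p x * Real.log (Real.exp (f x / β) / Z)) =
      fun x => β⁻¹ * (f x * p x) - Real.log Z * p x := by
    ext x
    rw [Real.log_div (Real.exp_ne_zero _) hZ_pos.ne', Real.log_exp]
    ring
  refine ae_eq_of_integral_mul_log_eq hp_nonneg (.of_forall fun x => by positivity) hp_int
    (hexp.div_const Z) ?_ hp_ent ?_ ?_
  · rw [integral_div, ← hZ, hp_one, div_self hZ_pos.ne']
  · rw [h_log]
    exact (hfp.const_mul _).sub (hp_int.const_mul _)
  · rw [h_log, integral_sub (hfp.const_mul _) (hp_int.const_mul _), integral_const_mul,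
      integral_const_mul, hp_one]
    field_simp
    linarith
end

section
/- Let (X, 𝒜, μ) be a probability space, β > 0, and f : X → ℝ a bounded measurable function. The supremum, over all probability densities p with respect to μ with ∫ p log p dμ finite, of the quantity ∫ f·p dμ − β ∫ p log p dμ equals β · log(∫ exp(f/β) dμ), and this supremum is attained by p* = exp(f/β) / ∫ exp(f/β) dμ. -/
open MeasureTheory

/-- The Fenchel–Young inequality for the conjugate pair `p ↦ p log p - p` and `exp`. -/
lemma mul_sub_mul_log_le_exp_sub {p : ℝ} (hp : 0 ≤ p) (t : ℝ) :
    p * t - p * Real.log p ≤ Real.exp t - p := by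
  rcases hp.eq_or_lt with rfl | hp
  · simpa using (Real.exp_pos t).le
  · have h := mul_le_mul_of_nonneg_left (Real.add_one_le_exp (t - Real.log p)) hp.le
    rw [Real.exp_sub, Real.exp_log hp, mul_div_cancel₀ _ hp.ne'] at h
    linarith

lemma integrable_exp_div_of_abs_le {X : Type*} [MeasurableSpace X] {μ : Measure X}
    [IsFiniteMeasure μ] {β : ℝ} (hβ : 0 < β) {f : X → ℝ} (hf : Measurable f) {M : ℝ}
    (hM : ∀ x, |f x| ≤ M) : Integrable (fun x => Real.exp (f x / β)) μ := by
  refine Integrable.of_bound (by fun_prop) (Real.exp (M / β)) (ae_of_all _ fun x => ?_)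
  rw [Real.norm_of_nonneg (Real.exp_pos _).le]
  gcongr
  exact (le_abs_self _).trans (hM x)

lemma integrable_mul_of_abs_le {X : Type*} [MeasurableSpace X] {μ : Measure X}
    {f p : X → ℝ} (hf : Measurable f) {M : ℝ} (hM : ∀ x, |f x| ≤ M) (hp : Integrable p μ) :
    Integrable (fun x => f x * p x) μ :=
  hp.bdd_mul hf.aestronglyMeasurable (ae_of_all _ hM)

/-- The optimal value of the entropy-regularized problem: for a probability space `(X, μ)`,
`β > 0` and a bounded measurable `f`, the supremum over probability densities `p` (with finite
entropy term) of `∫ f·p dμ − β ∫ p log p dμ` equals `β · log (∫ exp(f/β) dμ)`, i.e. this value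
is the greatest element of the set of achievable values, and it is attained by
`p* = exp(f/β) / ∫ exp(f/β) dμ`. -/
theorem gibbs_variational_principle
    {X : Type*} [MeasurableSpace X] (μ : Measure X) [IsProbabilityMeasure μ]
    (β : ℝ) (hβ : 0 < β)
    (f : X → ℝ) (hf_meas : Measurable f) (M : ℝ) (hf_bdd : ∀ x, |f x| ≤ M) :
    IsGreatest
      {v : ℝ | ∃ p : X → ℝ, Measurable p ∧ (∀ᵐ x ∂μ, 0 ≤ p x) ∧ Integrable p μ ∧
        (∫ x, p x ∂μ) = 1 ∧ Integrable (fun x => p x * Real.log (p x)) μ ∧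
        v = (∫ x, f x * p x ∂μ) - β * (∫ x, p x * Real.log (p x) ∂μ)}
      (β * Real.log (∫ x, Real.exp (f x / β) ∂μ)) ∧
    (∫ x, f x * (Real.exp (f x / β) / ∫ y, Real.exp (f y / β) ∂μ) ∂μ)
      - β * (∫ x, (Real.exp (f x / β) / ∫ y, Real.exp (f y / β) ∂μ) *
          Real.log (Real.exp (f x / β) / ∫ y, Real.exp (f y / β) ∂μ) ∂μ)
      = β * Real.log (∫ x, Real.exp (f x / β) ∂μ) := by
  set Z := ∫ x, Real.exp (f x / β) ∂μ with hZ
  have hexp : Integrable (fun x => Real.exp (f x / β)) μ :=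
    integrable_exp_div_of_abs_le hβ hf_meas hf_bdd
  have hZpos : 0 < Z := integral_exp_pos hexp
  have hq : Integrable (fun x => Real.exp (f x / β) / Z) μ := hexp.div_const Z
  have hq_one : ∫ x, Real.exp (f x / β) / Z ∂μ = 1 := by
    rw [integral_div, ← hZ, div_self hZpos.ne']
  have hfq := integrable_mul_of_abs_le hf_meas hf_bdd hq
  have hlog (x : X) : Real.log (Real.exp (f x / β) / Z) = f x / β - Real.log Z := by
    rw [Real.log_div (Real.exp_pos _).ne' hZpos.ne', Real.log_exp]
  have hqlog (x : X) : Real.exp (f x / β) / Z * Real.log (Real.exp (f x / β) / Z) =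
      f x * (Real.exp (f x / β) / Z) / β - Real.log Z * (Real.exp (f x / β) / Z) := by
    rw [hlog]; ring
  have hval : (∫ x, f x * (Real.exp (f x / β) / Z) ∂μ)
      - β * (∫ x, Real.exp (f x / β) / Z * Real.log (Real.exp (f x / β) / Z) ∂μ)
      = β * Real.log Z := by
    simp_rw [hqlog]
    rw [integral_sub (hfq.div_const β) (hq.const_mul _), integral_div, integral_const_mul,
      hq_one]
    field_simp
    ring
  refine ⟨⟨⟨fun x => Real.exp (f x / β) / Z, by fun_prop,
    ae_of_all _ fun x => by positivity, hq, hq_one, ?_, hval.symm⟩, ?_⟩, hval⟩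
  · simp_rw [hqlog]
    exact (hfq.div_const β).sub (hq.const_mul _)
  · rintro v ⟨p, -, hp_nonneg, hp, hp_one, hplog, rfl⟩
    have hfp := integrable_mul_of_abs_le hf_meas hf_bdd hp
    have hle : ∫ x, (f x * p x / β - p x * Real.log (p x)) ∂μ ≤
        ∫ x, (Real.exp (f x / β) / Z + (Real.log Z - 1) * p x) ∂μ := by
      refine integral_mono_ae ((hfp.div_const β).sub hplog) (hq.add (hp.const_mul _)) ?_
      filter_upwards [hp_nonneg] with x hx
      have h := mul_sub_mul_log_le_exp_sub hx (f x / β - Real.log Z)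
      rw [Real.exp_sub, Real.exp_log hZpos] at h
      linear_combination h
    rw [integral_sub (hfp.div_const β) hplog, integral_add hq (hp.const_mul _), integral_div,
      integral_const_mul, hq_one, hp_one] at hle
    have h := mul_le_mul_of_nonneg_left hle hβ.le
    rw [mul_sub, mul_div_cancel₀ _ hβ.ne'] at h
    linarith
end

section
/- Let Ω ⊆ ℝ^d be a measurable set with Lebesgue measure 1 that satisfies a Poincaré inequality with constant C > 0, and let β > 0. Let h : Ω → ℝ be a nonnegative square-integrable function, and let p : ℝ^d → ℝ be a continuously differentiable function with p ≥ 0 on Ω, ∫_Ω p dx = 1, and ∫_Ω h·p dx − β ∫_Ω ‖∇p‖² dx ≥ ∫_Ω h dx (i.e. p scores at least as well as the uniform density for the gradient-regularized functional). Then (1/C)·(∫_Ω (p − 1)² dx)^{1/2} ≤ (∫_Ω ‖∇p‖² dx)^{1/2} ≤ (C/β)·(∫_Ω h² dx)^{1/2}; in particular (∫_Ω (p − 1)² dx)^{1/2} ≤ (C²/β)·(∫_Ω h² dx)^{1/2}. -/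
open MeasureTheory

/-- Cauchy–Schwarz inequality for real functions with integrable squares and product. -/
theorem integral_mul_le_sqrt_mul_sqrt {α : Type*} [MeasurableSpace α] {μ : Measure α}
    {f g : α → ℝ} (hf : Integrable (fun x => f x ^ 2) μ) (hg : Integrable (fun x => g x ^ 2) μ)
    (hfg : Integrable (fun x => f x * g x) μ) :
    ∫ x, f x * g x ∂μ ≤ √(∫ x, f x ^ 2 ∂μ) * √(∫ x, g x ^ 2 ∂μ) := by
  have hquad : ∀ t : ℝ, 0 ≤ (∫ x, f x ^ 2 ∂μ) * (t * t) + (-2 * ∫ x, f x * g x ∂μ) * t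
      + ∫ x, g x ^ 2 ∂μ := by
    intro t
    have hnonneg : 0 ≤ ∫ x, (t * t * f x ^ 2 + -2 * t * (f x * g x) + g x ^ 2) ∂μ :=
      integral_nonneg fun x => by
        have := sq_nonneg (t * f x - g x)
        simp only [Pi.zero_apply]
        linarith
    rw [integral_add (by exact (hf.const_mul _).add (hfg.const_mul _)) hg,
      integral_add (hf.const_mul _) (hfg.const_mul _), integral_const_mul,
      integral_const_mul] at hnonneg
    linarith
  have hdiscrim := discrim_le_zero hquad
  rw [← Real.sqrt_mul (integral_nonneg fun x => sq_nonneg (f x))]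
  apply Real.le_sqrt_of_sq_le
  rw [discrim] at hdiscrim
  linarith

/-- Let `Ω ⊆ ℝ^d` have Lebesgue measure 1 and satisfy a Poincaré inequality with constant
`C > 0`, and let `β > 0`. If `h ≥ 0` is square-integrable on `Ω` and `p` is a continuously
differentiable probability density on `Ω` scoring at least as well as the uniform density for
the gradient-regularized functional, then
`(1/C)·‖p − 1‖_{L²} ≤ ‖∇p‖_{L²} ≤ (C/β)·‖h‖_{L²}`, and in particular
`‖p − 1‖_{L²} ≤ (C²/β)·‖h‖_{L²}`. -/
theorem gradient_regularized_density_bounds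
    {d : ℕ} (Ω : Set (EuclideanSpace ℝ (Fin d))) (hΩ : MeasurableSet Ω)
    (hvol : volume Ω = 1)
    (C : ℝ) (hC : 0 < C)
    (hPoincare : ∀ g : EuclideanSpace ℝ (Fin d) → ℝ, ContDiff ℝ 1 g →
      (∫ x in Ω, g x) = 0 →
      (∫ x in Ω, (g x) ^ 2) ≤ C ^ 2 * ∫ x in Ω, ‖gradient g x‖ ^ 2)
    (β : ℝ) (hβ : 0 < β)
    (h : EuclideanSpace ℝ (Fin d) → ℝ)
    (hh_nonneg : ∀ x ∈ Ω, 0 ≤ h x)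
    (hh_int : IntegrableOn h Ω)
    (hh_sq_int : IntegrableOn (fun x => (h x) ^ 2) Ω)
    (p : EuclideanSpace ℝ (Fin d) → ℝ) (hp_C1 : ContDiff ℝ 1 p)
    (hp_nonneg : ∀ x ∈ Ω, 0 ≤ p x)
    (hp_one : (∫ x in Ω, p x) = 1)
    (hp_int : IntegrableOn p Ω)
    (hp_sq_int : IntegrableOn (fun x => (p x) ^ 2) Ω)
    (hgrad_sq_int : IntegrableOn (fun x => ‖gradient p x‖ ^ 2) Ω)
    (hhp_int : IntegrableOn (fun x => h x * p x) Ω)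
    (hscore : (∫ x in Ω, h x) ≤
      (∫ x in Ω, h x * p x) - β * ∫ x in Ω, ‖gradient p x‖ ^ 2) :
    (1 / C) * Real.sqrt (∫ x in Ω, (p x - 1) ^ 2)
        ≤ Real.sqrt (∫ x in Ω, ‖gradient p x‖ ^ 2) ∧
    Real.sqrt (∫ x in Ω, ‖gradient p x‖ ^ 2)
        ≤ (C / β) * Real.sqrt (∫ x in Ω, (h x) ^ 2) ∧
    Real.sqrt (∫ x in Ω, (p x - 1) ^ 2)
        ≤ (C ^ 2 / β) * Real.sqrt (∫ x in Ω, (h x) ^ 2) := by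
  have hprob : IsProbabilityMeasure (volume.restrict Ω) := ⟨by simp [hvol]⟩
  have hmean : (∫ x in Ω, (p x - 1)) = 0 := by
    rw [integral_sub hp_int (integrable_const 1), hp_one]
    simp
  have hgrad : ∀ x, gradient (fun y => p y - 1) x = gradient p x := fun x => by
    simp [gradient, fderiv_sub_const]
  have hpoin := hPoincare (fun x => p x - 1) (hp_C1.sub contDiff_const) hmean
  simp only [hgrad] at hpoin
  have hdev_sq : Integrable (fun x => (p x - 1) ^ 2) (volume.restrict Ω) :=
    ((hp_sq_int.sub (hp_int.const_mul 2)).add (integrable_const 1)).congr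
      (.of_forall fun x => by simp only [Pi.add_apply, Pi.sub_apply]; ring)
  have hprod_eq : (fun x => h x * (p x - 1)) = fun x => h x * p x - h x := by
    funext x
    ring
  have hprod : Integrable (fun x => h x * (p x - 1)) (volume.restrict Ω) := by
    rw [hprod_eq]
    exact hhp_int.sub hh_int
  have hcs := integral_mul_le_sqrt_mul_sqrt hh_sq_int hdev_sq hprod
  rw [hprod_eq, integral_sub hhp_int hh_int] at hcs
  have hG : 0 ≤ ∫ x in Ω, ‖gradient p x‖ ^ 2 := integral_nonneg fun x => sq_nonneg _
  have hdev_le : √(∫ x in Ω, (p x - 1) ^ 2) ≤ C * √(∫ x in Ω, ‖gradient p x‖ ^ 2) := by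
    refine (Real.sqrt_le_sqrt hpoin).trans_eq ?_
    rw [Real.sqrt_mul (sq_nonneg C), Real.sqrt_sq hC.le]
  have hgrad_le : √(∫ x in Ω, ‖gradient p x‖ ^ 2) ≤ (C / β) * √(∫ x in Ω, (h x) ^ 2) := by
    have hsq := Real.mul_self_sqrt hG
    set G := √(∫ x in Ω, ‖gradient p x‖ ^ 2)
    have hH : 0 ≤ √(∫ x in Ω, (h x) ^ 2) := Real.sqrt_nonneg _
    have hG_nonneg : 0 ≤ G := Real.sqrt_nonneg _
    rcases hG_nonneg.eq_or_lt with hG0 | hGpos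
    · rw [← hG0]
      positivity
    · have hstep := mul_le_mul_of_nonneg_left hdev_le hH
      rw [div_mul_eq_mul_div, le_div_iff₀ hβ]
      refine le_of_mul_le_mul_right ?_ hGpos
      rw [← hsq] at hscore
      linarith
  refine ⟨?_, hgrad_le, ?_⟩
  · rwa [one_div_mul_eq_div, div_le_iff₀' hC]
  · calc √(∫ x in Ω, (p x - 1) ^ 2) ≤ C * √(∫ x in Ω, ‖gradient p x‖ ^ 2) := hdev_le
      _ ≤ C * ((C / β) * √(∫ x in Ω, (h x) ^ 2)) := mul_le_mul_of_nonneg_left hgrad_le hC.le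
      _ = (C ^ 2 / β) * √(∫ x in Ω, (h x) ^ 2) := by ring
end

section
/- Let Ω ⊆ ℝ^d be a measurable set with Lebesgue measure 1 that satisfies a Poincaré inequality with constant C > 0, and let β > 0. Let (h_n) be a sequence of nonnegative square-integrable functions h_n : Ω → ℝ with ∫_Ω h_n² dx → 0, and for each n let p_n : ℝ^d → ℝ be a continuously differentiable function with p_n ≥ 0 on Ω, ∫_Ω p_n dx = 1, and ∫_Ω h_n·p_n dx − β ∫_Ω ‖∇p_n‖² dx ≥ ∫_Ω h_n dx. Then, as n → ∞: ∫_Ω (p_n − 1)² dx → 0, ∫_Ω ‖∇p_n‖² dx → 0, and the values ∫_Ω h_n·p_n dx − β ∫_Ω ‖∇p_n‖² dx converge to 0. In particular, the densities p_n converge in L²(Ω) to the uniform density 1. -/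
open MeasureTheory Filter

/-- The square of the mean is at most the mean of the square. -/
theorem sq_integral_le_integral_sq {α : Type*} [MeasurableSpace α] {μ : Measure α}
    [IsProbabilityMeasure μ] {f : α → ℝ} (hf : Integrable f μ)
    (hf_sq : Integrable (fun x => f x ^ 2) μ) :
    (∫ x, f x ∂μ) ^ 2 ≤ ∫ x, f x ^ 2 ∂μ := by
  set m := ∫ x, f x ∂μ with hm
  have hle : ∫ x, (2 * m * f x - m ^ 2) ∂μ ≤ ∫ x, f x ^ 2 ∂μ :=
    integral_mono ((hf.const_mul _).sub (integrable_const _)) hf_sq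
      fun x => by nlinarith [sq_nonneg (f x - m)]
  rw [integral_sub (hf.const_mul _) (integrable_const _), integral_const_mul, ← hm] at hle
  simp only [integral_const, probReal_univ, one_smul] at hle
  linarith

/-- Young's inequality with a parameter, in integrated form. -/
theorem integral_mul_le_young {α : Type*} [MeasurableSpace α] {μ : Measure α} {f g : α → ℝ}
    (hfg : Integrable (fun x => f x * g x) μ) (hf : Integrable (fun x => f x ^ 2) μ)
    (hg : Integrable (fun x => g x ^ 2) μ) {t : ℝ} (ht : 0 < t) :
    ∫ x, f x * g x ∂μ ≤ t / 2 * (∫ x, f x ^ 2 ∂μ) + 1 / (2 * t) * ∫ x, g x ^ 2 ∂μ := by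
  rw [← integral_const_mul, ← integral_const_mul,
    ← integral_add (hf.const_mul _) (hg.const_mul _)]
  refine integral_mono hfg ((hf.const_mul _).add (hg.const_mul _)) fun x => ?_
  have key : t / 2 * f x ^ 2 + 1 / (2 * t) * g x ^ 2 - f x * g x
      = (t * f x - g x) ^ 2 / (2 * t) := by
    field_simp
    ring
  have : 0 ≤ (t * f x - g x) ^ 2 / (2 * t) := by positivity
  beta_reduce
  linarith

/-- Let `Ω ⊆ ℝ^d` have Lebesgue measure 1 and satisfy a Poincaré inequality with constant
`C > 0`, and let `β > 0`. Given nonnegative square-integrable `h_n` with `∫ h_n² → 0` and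
continuously differentiable probability densities `p_n` each scoring at least as well as the
uniform density for the gradient-regularized functional built from `h_n`, we have
`∫ (p_n − 1)² → 0`, `∫ ‖∇p_n‖² → 0`, and the values
`∫ h_n·p_n − β ∫ ‖∇p_n‖²` converge to `0`; in particular `p_n → 1` in `L²(Ω)`. -/
theorem gradient_regularized_densities_tendsto_uniform
    {d : ℕ} (Ω : Set (EuclideanSpace ℝ (Fin d))) (hΩ : MeasurableSet Ω)
    (hvol : volume Ω = 1)
    (C : ℝ) (hC : 0 < C)
    (hPoincare : ∀ g : EuclideanSpace ℝ (Fin d) → ℝ, ContDiff ℝ 1 g →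
      (∫ x in Ω, g x) = 0 →
      (∫ x in Ω, (g x) ^ 2) ≤ C ^ 2 * ∫ x in Ω, ‖gradient g x‖ ^ 2)
    (β : ℝ) (hβ : 0 < β)
    (h : ℕ → EuclideanSpace ℝ (Fin d) → ℝ)
    (hh_nonneg : ∀ n, ∀ x ∈ Ω, 0 ≤ h n x)
    (hh_int : ∀ n, IntegrableOn (h n) Ω)
    (hh_sq_int : ∀ n, IntegrableOn (fun x => (h n x) ^ 2) Ω)
    (hh_sq_tendsto : Tendsto (fun n => ∫ x in Ω, (h n x) ^ 2) atTop (nhds 0))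
    (p : ℕ → EuclideanSpace ℝ (Fin d) → ℝ) (hp_C1 : ∀ n, ContDiff ℝ 1 (p n))
    (hp_nonneg : ∀ n, ∀ x ∈ Ω, 0 ≤ p n x)
    (hp_one : ∀ n, (∫ x in Ω, p n x) = 1)
    (hp_int : ∀ n, IntegrableOn (p n) Ω)
    (hp_sq_int : ∀ n, IntegrableOn (fun x => (p n x) ^ 2) Ω)
    (hgrad_sq_int : ∀ n, IntegrableOn (fun x => ‖gradient (p n) x‖ ^ 2) Ω)
    (hhp_int : ∀ n, IntegrableOn (fun x => h n x * p n x) Ω)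
    (hscore : ∀ n, (∫ x in Ω, h n x) ≤
      (∫ x in Ω, h n x * p n x) - β * ∫ x in Ω, ‖gradient (p n) x‖ ^ 2) :
    Tendsto (fun n => ∫ x in Ω, (p n x - 1) ^ 2) atTop (nhds 0) ∧
    Tendsto (fun n => ∫ x in Ω, ‖gradient (p n) x‖ ^ 2) atTop (nhds 0) ∧
    Tendsto (fun n => (∫ x in Ω, h n x * p n x) - β * ∫ x in Ω, ‖gradient (p n) x‖ ^ 2)
      atTop (nhds 0) := by
  have : IsProbabilityMeasure (volume.restrict Ω) := ⟨by simpa using hvol⟩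
  set G : ℕ → ℝ := fun n => ∫ x in Ω, ‖gradient (p n) x‖ ^ 2
  set V : ℕ → ℝ := fun n => ∫ x in Ω, (p n x - 1) ^ 2
  set H : ℕ → ℝ := fun n => ∫ x in Ω, (h n x) ^ 2
  have hV_nonneg n : 0 ≤ V n := integral_nonneg fun x => sq_nonneg _
  have hG_nonneg n : 0 ≤ G n := integral_nonneg fun x => sq_nonneg _
  have hVG n : V n ≤ C ^ 2 * G n := by
    have hgrad x : gradient (fun y => p n y - 1) x = gradient (p n) x := by
      simp only [gradient, fderiv_sub_const]
    have hmean : ∫ x in Ω, (p n x - 1) = 0 := by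
      rw [integral_sub (hp_int n) (integrable_const _), hp_one n]
      simp
    simpa only [hgrad] using hPoincare _ ((hp_C1 n).sub contDiff_const) hmean
  have hcross n : (∫ x in Ω, h n x * p n x) - (∫ x in Ω, h n x)
      ≤ C ^ 2 / (2 * β) * H n + β / 2 * G n := by
    have hdev : Integrable (fun x => h n x * (p n x - 1)) (volume.restrict Ω) :=
      ((hhp_int n).sub (hh_int n)).congr (.of_forall fun x => by simp; ring)
    have hdev_sq : Integrable (fun x => (p n x - 1) ^ 2) (volume.restrict Ω) :=
      (((hp_sq_int n).sub ((hp_int n).const_mul 2)).add (integrable_const 1)).congr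
        (.of_forall fun x => by simp; ring)
    have hyoung := integral_mul_le_young hdev (hh_sq_int n) hdev_sq
      (t := C ^ 2 / β) (by positivity)
    have hsplit : ∫ x in Ω, h n x * (p n x - 1)
        = (∫ x in Ω, h n x * p n x) - ∫ x in Ω, h n x := by
      rw [← integral_sub (hhp_int n) (hh_int n)]
      exact integral_congr_ae (.of_forall fun x => by simp; ring)
    rw [hsplit] at hyoung
    calc _ ≤ C ^ 2 / β / 2 * H n + 1 / (2 * (C ^ 2 / β)) * V n := hyoung
      _ ≤ C ^ 2 / β / 2 * H n + 1 / (2 * (C ^ 2 / β)) * (C ^ 2 * G n) := by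
        gcongr
        exact hVG n
      _ = _ := by field_simp
  have hGH n : G n ≤ C ^ 2 / β ^ 2 * H n := by
    have h1 : β * G n ≤ C ^ 2 / (2 * β) * H n + β / 2 * G n := by
      linarith [hscore n, hcross n]
    have h2 : C ^ 2 / (2 * β) * H n = β / 2 * (C ^ 2 / β ^ 2 * H n) := by field_simp
    nlinarith
  have hG_lim : Tendsto G atTop (nhds 0) :=
    squeeze_zero hG_nonneg hGH (by simpa using hh_sq_tendsto.const_mul (C ^ 2 / β ^ 2))
  have hV_lim : Tendsto V atTop (nhds 0) :=
    squeeze_zero hV_nonneg hVG (by simpa using hG_lim.const_mul (C ^ 2))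
  have hmean_nonneg n : 0 ≤ ∫ x in Ω, h n x := setIntegral_nonneg hΩ (hh_nonneg n)
  have hmean_le n : ∫ x in Ω, h n x ≤ √(H n) :=
    Real.le_sqrt_of_sq_le (sq_integral_le_integral_sq (hh_int n) (hh_sq_int n))
  refine ⟨hV_lim, hG_lim,
    squeeze_zero (g := fun n => √(H n) + C ^ 2 / (2 * β) * H n)
      (fun n => (hmean_nonneg n).trans (hscore n)) (fun n => ?_) ?_⟩
  · have := mul_nonneg hβ.le (hG_nonneg n)
    linarith [hcross n, hmean_le n]
  · simpa using hh_sq_tendsto.sqrt.add (hh_sq_tendsto.const_mul (C ^ 2 / (2 * β)))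
end
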